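/- Let (X_n) be a regular sequence of compact length surfaces, each with q > 1 boundary components and reduced connectivity number c, converging in the Gromov-Hausdorff sense to X, with doubles 2X_n converging to 2X containing the isometric copies X^+, X^- of X and with (∂X_n) converging to ∂∞X. If b is a connected component of ∂∞X, then there is a maximal cyclic subset of 2X which intersects both b^+ and a further connected component of (∂∞X)^+. -/

import Mathlib

open Filter Topology Metric Set GromovHausdorff
open scoped ENNReal unitInterval

noncomputable section

/-! ## Model spaces -/

/-- The closed upper half plane in `ℝ × ℝ` (used for topological charts). -/
def HalfPlane : Set (ℝ × ℝ) := {p | 0 ≤ p.2}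

/-- The closed upper half plane in the Euclidean plane (used for metric charts). -/
def EHalfPlane : Set (EuclideanSpace ℝ (Fin 2)) := {p | 0 ≤ p 1}

/-- The unit circle (the 1-sphere). -/
def Circle1 : Set (EuclideanSpace ℝ (Fin 2)) := Metric.sphere 0 1

/-- The 2-sphere. -/
def Sphere2 : Set (EuclideanSpace ℝ (Fin 3)) := Metric.sphere 0 1

/-- The closed 2-disc. -/
def Disc2 : Set (EuclideanSpace ℝ (Fin 2)) := Metric.closedBall 0 1

/-- The relation on the unit square generating the Möbius identification
`(0, y) ∼ (1, 1 - y)`. -/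
def mobiusRel (p q : I × I) : Prop :=
  ((p.1 : ℝ) = 0 ∧ (q.1 : ℝ) = 1 ∧ (p.2 : ℝ) = 1 - (q.2 : ℝ)) ∨
  ((p.1 : ℝ) = 1 ∧ (q.1 : ℝ) = 0 ∧ (p.2 : ℝ) = 1 - (q.2 : ℝ))

/-- The Möbius band, as a quotient of the unit square. -/
def MobiusBand : Type := Quot mobiusRel

instance : TopologicalSpace MobiusBand :=
  inferInstanceAs (TopologicalSpace (Quot mobiusRel))

/-! ## Surfaces -/

/-- A topological 2-manifold with (possibly empty) boundary: every point has an open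
neighborhood homeomorphic to an open subset of the closed half plane. -/
def IsSurface (X : Type*) [TopologicalSpace X] : Prop :=
  ∀ x : X, ∃ (U : Set X) (V : Set HalfPlane),
    IsOpen U ∧ x ∈ U ∧ IsOpen V ∧ Nonempty (↥U ≃ₜ ↥V)

/-- A compact surface: a compact connected (Hausdorff) topological 2-manifold with
possibly empty boundary. -/
def IsCompactSurface (X : Type*) [TopologicalSpace X] : Prop :=
  CompactSpace X ∧ ConnectedSpace X ∧ T2Space X ∧ IsSurface X

/-- The (manifold) boundary of a surface: the set of points having no open neighborhood
homeomorphic to an open subset of the plane. -/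
def surfaceBoundary (X : Type*) [TopologicalSpace X] : Set X :=
  {x | ¬ ∃ (U : Set X) (V : Set (ℝ × ℝ)), IsOpen U ∧ x ∈ U ∧ IsOpen V ∧ Nonempty (↥U ≃ₜ ↥V)}

/-- The set of boundary components of a surface, i.e. the connected components of the
boundary. -/
def surfaceBoundaryComponents (X : Type*) [TopologicalSpace X] : Set (Set X) :=
  {b | ∃ x ∈ surfaceBoundary X, b = connectedComponentIn (surfaceBoundary X) x}

/-- A surface is orientable iff it contains no subset homeomorphic to the Möbius band. -/
def SurfOrientable (X : Type*) [TopologicalSpace X] : Prop :=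
  ¬ ∃ A : Set X, Nonempty (↥A ≃ₜ MobiusBand)

/-- The free rank of the first homology (the abelianized fundamental group). -/
noncomputable def h1Rank (X : Type*) [TopologicalSpace X] : ℕ :=
  ⨆ x : X, (Module.rank ℤ (Additive (Abelianization (FundamentalGroup X x)))).toNat

open Classical in
/-- The connectivity number of a compact surface `S`, i.e. `2 - χ(S)`.  By the
classification of compact surfaces this equals the free rank of the first homology,
plus one unless the surface is closed and orientable. -/
noncomputable def connNum (X : Type*) [TopologicalSpace X] : ℕ :=
  h1Rank X + (if surfaceBoundary X = ∅ ∧ SurfOrientable X then 0 else 1)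

/-- The reduced connectivity number: the connectivity number minus the number of
boundary components. -/
noncomputable def redConnNum (X : Type*) [TopologicalSpace X] : ℤ :=
  (connNum X : ℤ) - ((surfaceBoundaryComponents X).ncard : ℤ)

/-! ## Length and geodesic spaces -/

/-- The length of a path, as the total variation of the parametrization. -/
noncomputable def pathLength {X : Type*} [MetricSpace X] {x y : X} (γ : Path x y) : ℝ≥0∞ :=
  eVariationOn (fun t => γ t) Set.univ

/-- A metric space is a length space if the distance between any two points is the
infimum of the lengths of paths joining them. -/
def IsLengthSpace (X : Type*) [MetricSpace X] : Prop :=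
  ∀ x y : X, edist x y = ⨅ γ : Path x y, pathLength γ

/-- A metric space is geodesic if any two points are joined by a path whose length
realizes the distance. -/
def IsGeodesicSpace (X : Type*) [MetricSpace X] : Prop :=
  ∀ x y : X, ∃ γ : Path x y, pathLength γ = edist x y

/-! ## Peano spaces, Jordan curves and cyclic elements -/

/-- A Peano space: a compact connected locally connected metric space. -/
def IsPeano (X : Type*) [MetricSpace X] : Prop :=
  CompactSpace X ∧ ConnectedSpace X ∧ LocallyConnectedSpace X

/-- A Jordan curve: a subset homeomorphic to the 1-sphere. -/
def IsJordanCurve {X : Type*} [TopologicalSpace X] (J : Set X) : Prop :=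
  Nonempty (↥J ≃ₜ ↥Circle1)

/-- A set is cyclicly connected if every pair of distinct points of it lies on a common
Jordan curve contained in it. -/
def CycliclyConnected {X : Type*} [TopologicalSpace X] (A : Set X) : Prop :=
  ∀ x ∈ A, ∀ y ∈ A, x ≠ y → ∃ J : Set X, J ⊆ A ∧ IsJordanCurve J ∧ x ∈ J ∧ y ∈ J

/-- A maximal cyclic subset: a nondegenerate cyclicly connected subset which is not a
proper subset of any cyclicly connected subset. -/
def IsMaximalCyclic {X : Type*} [TopologicalSpace X] (A : Set X) : Prop :=
  A.Nontrivial ∧ CycliclyConnected A ∧ ∀ B : Set X, CycliclyConnected B → A ⊆ B → A = B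

/-- A subcontinuum: a compact connected (hence nonempty) subset. -/
def IsSubcontinuum {X : Type*} [TopologicalSpace X] (C : Set X) : Prop :=
  IsCompact C ∧ IsConnected C

/-- `b` is a boundary component of the subset `T` (viewed as a subspace). -/
def IsBoundaryComponentOf {X : Type*} [TopologicalSpace X] (T b : Set X) : Prop :=
  ∃ b' ∈ surfaceBoundaryComponents ↥T, b = Subtype.val '' b'

/-- An admissible subcontinuum: it meets every maximal cyclic subset `T` in at most a
point or in a boundary component of `T`. -/
def IsAdmissible {X : Type*} [TopologicalSpace X] (C : Set X) : Prop :=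
  IsSubcontinuum C ∧
    ∀ T : Set X, IsMaximalCyclic T →
      ((T ∩ C).Subsingleton ∨ IsBoundaryComponentOf T (T ∩ C))

/-- A 1-cactoid: a Peano space all of whose maximal cyclic subsets are homeomorphic to
the 1-sphere. -/
def IsOneCactoid (X : Type*) [MetricSpace X] : Prop :=
  IsPeano X ∧ ∀ T : Set X, IsMaximalCyclic T → Nonempty (↥T ≃ₜ ↥Circle1)

/-- A subset homeomorphic to the 2-sphere or the closed 2-disc. -/
def SphereOrDisc {X : Type*} [TopologicalSpace X] (T : Set X) : Prop :=
  Nonempty (↥T ≃ₜ ↥Sphere2) ∨ Nonempty (↥T ≃ₜ ↥Disc2)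

/-! ## Generalized cactoids -/

/-- A generalized cactoid. -/
def IsGeneralizedCactoid (X : Type*) [MetricSpace X] : Prop :=
  IsPeano X ∧ (∀ T : Set X, IsMaximalCyclic T → IsCompactSurface ↥T) ∧
  {T : Set X | IsMaximalCyclic T ∧ ¬ SphereOrDisc T}.Finite ∧
  ∃ (n : ℕ) (C : Fin n → Set X),
    (∀ i, IsAdmissible (C i)) ∧ (Pairwise fun i j => Disjoint (C i) (C j)) ∧
    ∀ T b : Set X, IsMaximalCyclic T → IsBoundaryComponentOf T b → b ⊆ ⋃ i, C i

/-- A pre-boundary consisting of `n` disjoint admissible subcontinua, each containing a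
boundary component of some maximal cyclic subset, which together cover all boundary
components of all maximal cyclic subsets. -/
def IsPreBoundaryOfSize {X : Type*} [TopologicalSpace X] (n : ℕ) (P : Set X) : Prop :=
  ∃ C : Fin n → Set X,
    (∀ i, IsAdmissible (C i)) ∧ (Pairwise fun i j => Disjoint (C i) (C j)) ∧
    (∀ i, ∃ T b : Set X, IsMaximalCyclic T ∧ IsBoundaryComponentOf T b ∧ b ⊆ C i) ∧
    (∀ T b : Set X, IsMaximalCyclic T → IsBoundaryComponentOf T b → b ⊆ ⋃ i, C i) ∧
    P = ⋃ i, C i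

def IsPreBoundary {X : Type*} [TopologicalSpace X] (P : Set X) : Prop :=
  ∃ n, IsPreBoundaryOfSize n P

/-- A minimal pre-boundary: one with the minimal possible number of pieces. -/
def IsMinimalPreBoundary {X : Type*} [TopologicalSpace X] (P : Set X) : Prop :=
  ∃ n, IsPreBoundaryOfSize n P ∧ ∀ (m : ℕ) (Q : Set X), IsPreBoundaryOfSize m Q → n ≤ m

/-- The boundary of a generalized cactoid: the union of all minimal pre-boundaries. -/
def cactoidBoundary (X : Type*) [TopologicalSpace X] : Set X :=
  ⋃₀ {P : Set X | IsMinimalPreBoundary P}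

/-- The boundary components of a generalized cactoid: the connected components of its
boundary. -/
def cactoidBoundaryComponents (X : Type*) [TopologicalSpace X] : Set (Set X) :=
  {b | ∃ x ∈ cactoidBoundary X, b = connectedComponentIn (cactoidBoundary X) x}

/-- The connectivity number of a generalized cactoid: the sum of the reduced
connectivity numbers of its maximal cyclic subsets plus the number of its boundary
components. -/
noncomputable def cactoidConnNum (X : Type*) [TopologicalSpace X] : ℤ :=
  (∑ᶠ T ∈ {T : Set X | IsMaximalCyclic T}, redConnNum ↥T) +
    ((cactoidBoundaryComponents X).ncard : ℤ)

/-! ## Bundled spaces -/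

structure BundledMet where
  carrier : Type
  [str : MetricSpace carrier]

attribute [instance] BundledMet.str

structure BundledTop where
  carrier : Type
  [str : TopologicalSpace carrier]

attribute [instance] BundledTop.str

/-! ## Metric two-point identifications -/

/-- `p : A → B` is (the projection of) a metric 2-point identification: it glues exactly
two distinct points `x₁, x₂` of `A` and carries the corresponding quotient metric. -/
def IsTwoPointIdentification {A B : Type*} [MetricSpace A] [MetricSpace B] (p : A → B) : Prop :=
  Function.Surjective p ∧ ∃ x₁ x₂ : A, x₁ ≠ x₂ ∧
    (∀ a b : A, p a = p b ↔ (a = b ∨ (a = x₁ ∧ b = x₂) ∨ (a = x₂ ∧ b = x₁))) ∧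
    ∀ a b : A, dist (p a) (p b) =
      min (dist a b) (min (dist a x₁ + dist x₂ b) (dist a x₂ + dist x₁ b))

/-- `Y` is obtained from `X` by a successive application of `k` metric 2-point
identifications, exactly `k₀` of which are boundary identifications with respect to the
subset `B ⊆ X`. -/
def ObtainedByIdentifications (X : Type) [MetricSpace X] (B : Set X) (k k0 : ℕ)
    (Y : Type) [MetricSpace Y] : Prop :=
  ∃ (Z : ℕ → BundledMet) (p : ∀ i : ℕ, (Z i).carrier → (Z (i + 1)).carrier)
    (e : X ≃ᵢ (Z 0).carrier) (f : (Z k).carrier ≃ᵢ Y) (q : ∀ i : ℕ, X → (Z i).carrier),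
    (∀ i, i < k → IsTwoPointIdentification (p i)) ∧
    (∀ x, q 0 x = e x) ∧ (∀ i x, q (i + 1) x = p i (q i x)) ∧
    {i : ℕ | i < k ∧ ∃ a b : (Z i).carrier,
        a ∈ q i '' B ∧ b ∈ q i '' B ∧ a ≠ b ∧ p i a = p i b}.ncard = k0

/-! ## Gromov–Hausdorff sequences of surfaces -/

/-- A sequence of (isometry classes of) compact length surfaces with connectivity
number `c`. -/
def IsSurfaceGHSeq (c : ℕ) (K : ℕ → GHSpace) : Prop :=
  ∀ n, IsCompactSurface (K n).Rep ∧ IsLengthSpace (K n).Rep ∧ connNum (K n).Rep = c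

/-- The structural description of the limit spaces in the Main Theorem: `X` is obtained
from a geodesic generalized cactoid `Y` by `k` successive metric 2-point
identifications, `k₀` of them boundary identifications, where the connectivity number
of `Y` is at most `c + k₀ - 2k`. -/
def MainThmRHS (c : ℕ) (X : Type) [MetricSpace X] : Prop :=
  ∃ (k k0 : ℕ) (Y : BundledMet),
    IsGeneralizedCactoid Y.carrier ∧ IsGeodesicSpace Y.carrier ∧
    ObtainedByIdentifications Y.carrier (cactoidBoundary Y.carrier) k k0 X ∧
    cactoidConnNum Y.carrier ≤ (c : ℤ) + (k0 : ℤ) - 2 * (k : ℤ)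

/-! ## Covering dimension -/

/-- `X` has covering dimension at most `n`: every open cover admits an open refinement
of order at most `n + 1`. -/
def CoveringDimLE (X : Type*) [TopologicalSpace X] (n : ℕ) : Prop :=
  ∀ U : Set (Set X), (∀ u ∈ U, IsOpen u) → ⋃₀ U = Set.univ →
    ∃ V : Set (Set X), (∀ v ∈ V, IsOpen v) ∧ ⋃₀ V = Set.univ ∧
      (∀ v ∈ V, ∃ u ∈ U, v ⊆ u) ∧
      ∀ x : X, {v | v ∈ V ∧ x ∈ v}.encard ≤ (n : ℕ∞) + 1

/-! ## Curves in surfaces -/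

/-- A continuous map from the circle is nullhomotopic if it is homotopic to a constant. -/
def IsNullhomotopic {X : Type*} [TopologicalSpace X] (f : C(↥Circle1, X)) : Prop :=
  ∃ y : X, f.Homotopic (ContinuousMap.const _ y)

/-- A contractible Jordan curve. -/
def IsContractibleJordanCurve {X : Type*} [TopologicalSpace X] (J : Set X) : Prop :=
  IsJordanCurve J ∧
    ∀ f : C(↥Circle1, X), Function.Injective f → Set.range f = J → IsNullhomotopic f

/-- A non-contractible Jordan curve. -/
def IsNonContractibleJordanCurve {X : Type*} [TopologicalSpace X] (J : Set X) : Prop :=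
  IsJordanCurve J ∧
    ∀ f : C(↥Circle1, X), Function.Injective f → Set.range f = J → ¬ IsNullhomotopic f

/-- A simple arc in a surface: an injective path whose endpoints lie on the boundary and
whose interior does not. -/
def IsSimpleArc {X : Type*} [TopologicalSpace X] (γ : C(I, X)) : Prop :=
  Function.Injective γ ∧ γ 0 ∈ surfaceBoundary X ∧ γ 1 ∈ surfaceBoundary X ∧
    ∀ t : I, t ≠ 0 → t ≠ 1 → γ t ∉ surfaceBoundary X

/-- A subset separates the space if its complement is disconnected. -/
def SeparatesSpace {X : Type*} [TopologicalSpace X] (A : Set X) : Prop :=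
  ¬ IsPreconnected Aᶜ

/-- The arc `γ` forms a contractible Jordan curve together with a subarc of some
boundary component. -/
def FormsContractibleJordanWithBoundary {X : Type*} [TopologicalSpace X]
    (γ : C(I, X)) : Prop :=
  ∃ β : C(I, X), Function.Injective β ∧ Set.range β ⊆ surfaceBoundary X ∧
    β 0 = γ 0 ∧ β 1 = γ 1 ∧ IsContractibleJordanCurve (Set.range γ ∪ Set.range β)

/-- `z` separates `x` and `y` inside the subset `A`: both lie in `A \ {z}` and no
connected subset of `A \ {z}` contains both. -/
def SeparatesIn {X : Type*} [TopologicalSpace X] (A : Set X) (z x y : X) : Prop :=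
  x ∈ A \ {z} ∧ y ∈ A \ {z} ∧
    ∀ C : Set X, C ⊆ A \ {z} → IsPreconnected C → ¬ (x ∈ C ∧ y ∈ C)

/-! ## Metric doubles -/

/-- `D` together with the two canonical maps `ip, im : X → D` is the metric double of
`X` along the subset `B`. -/
structure IsMetricDouble (X : Type*) [MetricSpace X] (B : Set X) (D : Type*)
    [MetricSpace D] (ip im : X → D) : Prop where
  isom_p : Isometry ip
  isom_m : Isometry im
  surj : Set.range ip ∪ Set.range im = Set.univ
  agree : ∀ z ∈ B, ip z = im z
  dist_mix : ∀ a b : X, dist (ip a) (im b) = ⨅ z : ↥B, (dist a (z : X) + dist (z : X) b)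

/-- Regularity of a sequence of doubles: there is no sequence of non-contractible
Jordan curves in the doubles with vanishing diameters. -/
def RegularDoubleSeq (D : ℕ → Type) [∀ n, MetricSpace (D n)] : Prop :=
  ∀ J : ∀ n, Set (D n), (∀ n, IsNonContractibleJordanCurve (J n)) →
    0 < ⨅ n, Metric.diam (J n)

/-- The copy `A^+` (or `A^-`) in the double limit corresponding to a subset `A` of the
limit `X`, via the isometric identification `j` of `X` with `X^+` (resp. `X^-`). -/
def plusCopy {Z D : Type*} {X : Set Z} {Xp : Set D} (j : ↥X → ↥Xp) (A : Set Z) :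
    Set D :=
  (fun x => ((j x : ↥Xp) : D)) '' {x : ↥X | (x : Z) ∈ A}

/-! ## Riemannian and polyhedral surfaces -/

/-- The Riemannian length integrand `√(g_{γ(t)}(γ'(t), γ'(t)))`. -/
noncomputable def riemLengthIntegrand (g : (ℝ × ℝ) → (ℝ × ℝ) → (ℝ × ℝ) → ℝ)
    (γ : ℝ → ℝ × ℝ) (t : ℝ) : ℝ :=
  Real.sqrt (g (γ t) (deriv γ t) (deriv γ t))

/-- A compact connected smooth Riemannian 2-manifold, as a metric space: a compact
length surface such that around every point there is a chart in which the length of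
every C¹ curve is computed by a smooth positive definite symmetric bilinear metric. -/
def IsSmoothRiemannianSurface (X : Type*) [MetricSpace X] : Prop :=
  IsCompactSurface X ∧ IsLengthSpace X ∧
  ∀ x : X, ∃ (U : Set X) (V : Set (ℝ × ℝ)) (φ : X → ℝ × ℝ) (ψ : ℝ × ℝ → X)
      (g : (ℝ × ℝ) → (ℝ × ℝ) → (ℝ × ℝ) → ℝ),
    IsOpen U ∧ x ∈ U ∧ (∃ V' : Set (ℝ × ℝ), IsOpen V' ∧ V = V' ∩ HalfPlane) ∧
    ContinuousOn φ U ∧ φ '' U = V ∧ ContinuousOn ψ V ∧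
    (∀ y ∈ U, ψ (φ y) = y) ∧ (∀ v ∈ V, φ (ψ v) = v) ∧
    (∀ m : ℕ, ContDiffOn ℝ m
      (fun pq : (ℝ × ℝ) × (ℝ × ℝ) × (ℝ × ℝ) => g pq.1 pq.2.1 pq.2.2)
      (V ×ˢ ((Set.univ : Set (ℝ × ℝ)) ×ˢ (Set.univ : Set (ℝ × ℝ))))) ∧
    (∀ p u v, g p u v = g p v u) ∧
    (∀ p (a : ℝ) u u' v, g p (a • u + u') v = a * g p u v + g p u' v) ∧
    (∀ p ∈ V, ∀ u : ℝ × ℝ, u ≠ 0 → 0 < g p u u) ∧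
    ∀ (cur : ℝ → X) (a b : ℝ), a ≤ b → Set.MapsTo cur (Set.Icc a b) U →
      ContDiffOn ℝ 1 (φ ∘ cur) (Set.Icc a b) →
      eVariationOn cur (Set.Icc a b) =
        ENNReal.ofReal (∫ t in a..b, riemLengthIntegrand g (φ ∘ cur) t)

/-- A polyhedral surface: a compact length surface which is flat (locally isometric to
a subset of the Euclidean half plane) away from finitely many singular points. -/
def IsPolyhedralSurface (X : Type*) [MetricSpace X] : Prop :=
  IsCompactSurface X ∧ IsLengthSpace X ∧
  ∃ F : Set X, F.Finite ∧ ∀ x : X, x ∉ F →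
    ∃ (U : Set X) (W : Set (EuclideanSpace ℝ (Fin 2))),
      IsOpen U ∧ x ∈ U ∧ W ⊆ EHalfPlane ∧ Nonempty (↥U ≃ᵢ ↥W)

end

/-! ## Geodesics in compact spaces with midpoints -/

/-- Every pair of points has a metric midpoint. -/
def HasMidpoints (X : Type*) [MetricSpace X] : Prop :=
  ∀ x y : X, ∃ m : X, dist x m = dist x y / 2 ∧ dist m y = dist x y / 2

theorem hasMidpoints_of_approx {X : Type*} [MetricSpace X] [CompactSpace X]
    (h : ∀ x y : X, ∀ ε > 0, ∃ m : X, dist x m ≤ dist x y / 2 + ε ∧ dist m y ≤ dist x y / 2 + ε) :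
    HasMidpoints X := by
  intro x y
  obtain ⟨m, -, hm⟩ := isCompact_univ.exists_isMinOn (s := (univ : Set X)) ⟨x, mem_univ x⟩
    (f := fun m => max (dist x m) (dist m y)) (by fun_prop)
  have hle : max (dist x m) (dist m y) ≤ dist x y / 2 := by
    refine le_of_forall_pos_le_add fun ε hε => ?_
    obtain ⟨k, hk₁, hk₂⟩ := h x y ε hε
    exact (hm (mem_univ k)).trans (max_le hk₁ hk₂)
  have h₁ := (le_max_left _ _).trans hle
  have h₂ := (le_max_right _ _).trans hle
  have := dist_triangle x m y
  exact ⟨m, by linarith, by linarith⟩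

theorem IsLengthSpace.exists_approx_midpoint {X : Type*} [MetricSpace X] (h : IsLengthSpace X)
    (x y : X) {ε : ℝ} (hε : 0 < ε) :
    ∃ m : X, dist x m ≤ dist x y / 2 + ε ∧ dist m y ≤ dist x y / 2 + ε := by
  have hlt : (⨅ γ : Path x y, pathLength γ) < edist x y + ENNReal.ofReal ε := by
    rw [← h x y]
    exact ENNReal.lt_add_right (edist_ne_top x y) (by simpa using hε)
  obtain ⟨γ, hγ⟩ := iInf_lt_iff.1 hlt
  obtain ⟨t, -, ht⟩ : ∃ t ∈ (univ : Set I), dist x (γ t) = dist x y / 2 := by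
    have hc : ContinuousOn (fun t : I => dist x (γ t)) univ := by fun_prop
    refine isPreconnected_univ.intermediate_value (mem_univ 0) (mem_univ 1) hc ⟨?_, ?_⟩
    · simp only [Path.source, dist_self]; positivity
    · simp only [Path.target]; linarith [dist_nonneg (x := x) (y := y)]
  refine ⟨γ t, by linarith, ?_⟩
  have hsum : edist x (γ t) + edist (γ t) y ≤ pathLength γ := by
    have hadd := eVariationOn.Icc_add_Icc (fun t => γ t) (s := univ) (a := (0 : I)) (b := t)
      (c := 1) t.2.1 t.2.2 (mem_univ t)
    have h₁ : edist x (γ t) ≤ eVariationOn (fun t => γ t) (univ ∩ Icc (0 : I) t) := by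
      have := eVariationOn.edist_le (fun t => γ t) (s := univ ∩ Icc (0 : I) t) (x := 0) (y := t)
        ⟨mem_univ _, le_rfl, t.2.1⟩ ⟨mem_univ _, t.2.1, le_rfl⟩
      simpa using this
    have h₂ : edist (γ t) y ≤ eVariationOn (fun t => γ t) (univ ∩ Icc t (1 : I)) := by
      have := eVariationOn.edist_le (fun t => γ t) (s := univ ∩ Icc t (1 : I)) (x := t) (y := 1)
        ⟨mem_univ _, le_rfl, t.2.2⟩ ⟨mem_univ _, t.2.2, le_rfl⟩
      simpa using this
    calc edist x (γ t) + edist (γ t) y ≤ _ := add_le_add h₁ h₂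
      _ = _ := hadd
      _ ≤ pathLength γ := eVariationOn.mono _ (subset_univ _)
  have hfin := hsum.trans_lt hγ
  rw [edist_dist, edist_dist, edist_dist, ← ENNReal.ofReal_add dist_nonneg dist_nonneg,
    ← ENNReal.ofReal_add dist_nonneg hε.le, ENNReal.ofReal_lt_ofReal_iff (by positivity)] at hfin
  linarith

/-- In a compact space with midpoints any two points are joined by a compact set which is
isometric to an interval via the distance from the first point. -/
theorem HasMidpoints.exists_geodesic_set {X : Type*} [MetricSpace X] [CompactSpace X]
    (hmid : HasMidpoints X) (p q : X) :
    ∃ S : Set X, IsCompact S ∧ p ∈ S ∧ q ∈ S ∧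
      (∀ s ∈ S, ∀ t ∈ S, dist s t = |dist p s - dist p t|) ∧
      (∀ s ∈ S, dist p s ≤ dist p q) ∧ ∀ r ∈ Icc 0 (dist p q), ∃ s ∈ S, dist p s = r := by
  let F : Set (Set X) := {S | p ∈ S ∧ q ∈ S ∧
    (∀ s ∈ S, ∀ t ∈ S, dist s t = |dist p s - dist p t|) ∧ ∀ s ∈ S, dist p s ≤ dist p q}
  have hbase : ({p, q} : Set X) ∈ F := by
    refine ⟨by simp, by simp, ?_, ?_⟩
    · rintro s (rfl | rfl) t (rfl | rfl) <;> simp [dist_comm]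
    · rintro s (rfl | rfl) <;> simp
  obtain ⟨S, -, hS⟩ := zorn_subset_nonempty F (by
    intro c hcF hc ⟨S₀, hS₀⟩
    refine ⟨⋃₀ c, ⟨mem_sUnion_of_mem (hcF hS₀).1 hS₀, mem_sUnion_of_mem (hcF hS₀).2.1 hS₀,
      ?_, ?_⟩, fun s hs => subset_sUnion_of_mem hs⟩
    · rintro s ⟨A, hA, hs⟩ t ⟨B, hB, ht⟩
      rcases hc.total hA hB with h | h
      · exact (hcF hB).2.2.1 s (h hs) t ht
      · exact (hcF hA).2.2.1 s hs t (h ht)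
    · rintro s ⟨A, hA, hs⟩
      exact (hcF hA).2.2.2 s hs) _ hbase
  obtain ⟨hp, hq, hdist, hbd⟩ := hS.prop
  have hclosed : IsClosed S := by
    refine isClosed_of_closure_subset (hS.le_of_ge (y := closure S) ?_ subset_closure)
    refine ⟨subset_closure hp, subset_closure hq, ?_, ?_⟩
    · intro s hs t ht
      have hcl : IsClosed {x : X × X | dist x.1 x.2 = |dist p x.1 - dist p x.2|} :=
        isClosed_eq (by fun_prop) (by fun_prop)
      have hsub : S ×ˢ S ⊆ {x : X × X | dist x.1 x.2 = |dist p x.1 - dist p x.2|} :=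
        fun x hx => hdist _ hx.1 _ hx.2
      have hmem : (s, t) ∈ closure (S ×ˢ S) := by
        rw [closure_prod_eq]; exact ⟨hs, ht⟩
      exact closure_minimal hsub hcl hmem
    · intro s hs
      exact closure_minimal (s := S) (t := {x | dist p x ≤ dist p q}) hbd
        (isClosed_le (by fun_prop) (by fun_prop)) hs
  refine ⟨S, hclosed.isCompact, hp, hq, hdist, hbd, ?_⟩
  intro r hr
  by_contra! hne
  have hK : IsCompact (dist p '' S) := hclosed.isCompact.image (by fun_prop)
  obtain ⟨a, ⟨⟨s, hs, rfl⟩, har⟩, hamax⟩ := (hK.inter_right (isClosed_Iic (a := r))).exists_isGreatest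
    ⟨0, ⟨p, hp, by simp⟩, hr.1⟩
  obtain ⟨b, ⟨⟨t, ht, rfl⟩, hbr⟩, hbmin⟩ := (hK.inter_right (isClosed_Ici (a := r))).exists_isLeast
    ⟨_, ⟨q, hq, rfl⟩, hr.2⟩
  have hsr : dist p s < r := lt_of_le_of_ne har (hne s hs)
  have htr : r < dist p t := lt_of_le_of_ne hbr (hne t ht).symm
  obtain ⟨m, hm₁, hm₂⟩ := hmid s t
  have hst : dist s t = dist p t - dist p s := by
    rw [hdist s hs t ht, abs_sub_comm, abs_of_pos (by linarith)]
  have hpm : dist p m = (dist p s + dist p t) / 2 := by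
    have h₁ := dist_triangle p s m
    have h₂ := dist_triangle p m t
    linarith
  have hmu : ∀ u ∈ S, dist m u = |dist p m - dist p u| := by
    intro u hu
    have htri₁ := dist_triangle p u m
    have htri₂ := dist_triangle p m u
    rw [dist_comm u m] at htri₁
    rcases le_total (dist p u) r with h | h
    · have hle : dist p u ≤ dist p s := hamax ⟨⟨u, hu, rfl⟩, h⟩
      have hus := hdist s hs u hu
      rw [abs_of_nonneg (by linarith)] at hus
      rw [abs_of_nonneg (by linarith)]
      have := dist_triangle m s u
      rw [dist_comm m s] at this
      linarith
    · have hle : dist p t ≤ dist p u := hbmin ⟨⟨u, hu, rfl⟩, h⟩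
      have hus := hdist u hu t ht
      rw [abs_of_nonneg (by linarith)] at hus
      rw [abs_of_nonpos (by linarith)]
      have := dist_triangle m t u
      rw [dist_comm t u] at this
      linarith
  have hins : insert m S ∈ F := by
    refine ⟨mem_insert_of_mem _ hp, mem_insert_of_mem _ hq, ?_, ?_⟩
    · rintro x (rfl | hx) y (rfl | hy)
      · simp
      · exact hmu y hy
      · rw [dist_comm, abs_sub_comm]; exact hmu x hx
      · exact hdist x hx y hy
    · rintro x (rfl | hx)
      · have := hbd t ht
        linarith
      · exact hbd x hx
  have hmS : m ∈ S := hS.le_of_ge hins (subset_insert _ _) (mem_insert _ _)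
  rcases le_total (dist p m) r with h | h
  · have : dist p m ≤ dist p s := hamax ⟨⟨m, hmS, rfl⟩, h⟩
    linarith
  · have : dist p t ≤ dist p m := hbmin ⟨⟨m, hmS, rfl⟩, h⟩
    linarith

/-! ## Jordan curves detected by maps to the circle -/

theorem circle_nonneg_angle_injOn {a b : ℝ} (ha : a ∈ Icc 0 Real.pi) (hb : b ∈ Icc 0 Real.pi)
    (h : Circle.exp a = Circle.exp b) : a = b :=
  Circle.exp_injOn_Icc (by linarith [Real.pi_pos]) ha hb h

theorem circle_exp_eq_exp_neg {a b : ℝ} (ha : a ∈ Icc 0 Real.pi) (hb : b ∈ Icc 0 Real.pi)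
    (h : Circle.exp a = Circle.exp (-b)) : a = b ∧ (a = 0 ∨ a = Real.pi) := by
  obtain ⟨m, hm⟩ := Circle.exp_eq_exp.1 h
  have hpi := Real.pi_pos
  have h₁ : 0 ≤ (m : ℝ) := by
    by_contra! hneg
    nlinarith [ha.1, hb.1]
  have h₂ : (m : ℝ) ≤ 1 := by
    by_contra! hneg
    nlinarith [ha.2, hb.2]
  have h₁' : 0 ≤ m := by exact_mod_cast h₁
  have h₂' : m ≤ 1 := by exact_mod_cast h₂
  obtain rfl | rfl : m = 0 ∨ m = 1 := by omega
  · simp only [Int.cast_zero, zero_mul, add_zero] at hm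
    have := ha.1
    have := hb.1
    exact ⟨by linarith, Or.inl (by linarith)⟩
  · simp only [Int.cast_one, one_mul] at hm
    have := ha.2
    have := hb.2
    exact ⟨by linarith, Or.inr (by linarith)⟩

/-- A homeomorphism between the unit circle in `ℂ` and the one in the Euclidean plane. -/
noncomputable def circleHomeoCircle1 : Circle ≃ₜ ↥Circle1 where
  toFun z := ⟨Complex.orthonormalBasisOneI.repr (z : ℂ), by
    rw [Circle1, mem_sphere_zero_iff_norm, LinearIsometryEquiv.norm_map, Circle.norm_coe]⟩
  invFun w := ⟨Complex.orthonormalBasisOneI.repr.symm (w : EuclideanSpace ℝ (Fin 2)),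
    mem_sphere_zero_iff_norm.2 <| by
      rw [LinearIsometryEquiv.norm_map]; exact mem_sphere_zero_iff_norm.1 w.2⟩
  left_inv z := Subtype.ext (Complex.orthonormalBasisOneI.repr.symm_apply_apply _)
  right_inv w := Subtype.ext (Complex.orthonormalBasisOneI.repr.apply_symm_apply _)
  continuous_toFun := by fun_prop
  continuous_invFun := by fun_prop

/-- A continuous real function on the circle is not injective. -/
theorem Circle.not_injective_of_continuous {f : Circle → ℝ} (hf : Continuous f) :
    ¬ Function.Injective f := by
  intro hinj
  have hc : Continuous fun t : ℝ => f (Circle.exp t) - f (Circle.exp (t + Real.pi)) := by fun_prop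
  have hper : f (Circle.exp (Real.pi + Real.pi)) = f (Circle.exp 0) := by
    rw [← two_mul, Circle.exp_two_pi, Circle.exp_zero]
  obtain ⟨t, ht⟩ : (0 : ℝ) ∈
      range fun t : ℝ => f (Circle.exp t) - f (Circle.exp (t + Real.pi)) := by
    rcases le_total (f (Circle.exp 0)) (f (Circle.exp Real.pi)) with h | h
    · refine mem_range_of_exists_le_of_exists_ge hc ⟨0, ?_⟩ ⟨Real.pi, ?_⟩
      · simpa using h
      · simpa only [hper, sub_nonneg] using h
    · refine mem_range_of_exists_le_of_exists_ge hc ⟨Real.pi, ?_⟩ ⟨0, ?_⟩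
      · simpa only [hper, sub_nonpos] using h
      · simpa using h
  obtain ⟨m, hm⟩ := Circle.exp_eq_exp.1 (hinj (sub_eq_zero.1 ht))
  have hpi := Real.pi_pos
  have h0 : (1 + 2 * (m : ℝ)) * Real.pi = 0 := by linarith
  have h1 : (1 + 2 * m : ℤ) = 0 := by
    exact_mod_cast (mul_eq_zero.1 h0).resolve_right hpi.ne'
  omega

theorem isNonContractibleJordanCurve_of_bijOn {D : Type*} [TopologicalSpace D] {J : Set D}
    (hJ : IsCompact J) (F : C(D, Circle)) (hF : BijOn F J univ) :
    IsNonContractibleJordanCurve J := by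
  have : CompactSpace J := isCompact_iff_compactSpace.1 hJ
  have hcont : Continuous (J.domRestrict F) := F.continuous.comp continuous_subtype_val
  have hbij : Function.Bijective (J.domRestrict F) :=
    ⟨injOn_iff_injective.1 hF.injOn, fun z => by
      obtain ⟨x, hx, rfl⟩ := hF.surjOn (mem_univ z)
      exact ⟨⟨x, hx⟩, rfl⟩⟩
  have hhomeo : IsHomeomorph (J.domRestrict F) :=
    isHomeomorph_iff_continuous_bijective.2 ⟨hcont, hbij⟩
  refine ⟨⟨hhomeo.homeomorph.trans circleHomeoCircle1⟩, ?_⟩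
  rintro f hf hrange ⟨y, ⟨H⟩⟩
  let G := H.symm
  obtain ⟨θ, hθ⟩ := Circle.exp_surjective (F y)
  let K : C(I × Circle1, Circle) := F.comp G.toContinuousMap
  have hK : ∀ a, K (0, a) = Circle.exp ((ContinuousMap.const Circle1 θ) a) := by
    intro a
    simp [K, G, hθ]
  have hlift := Circle.isCoveringMap_exp.liftHomotopy_lifts K (.const Circle1 θ) hK
  let L := Circle.isCoveringMap_exp.liftHomotopy K (.const Circle1 θ) hK
  have hL : ∀ a, Circle.exp (L (1, a)) = F (f a) := by
    intro a
    have := congr_fun hlift (1, a)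
    simpa [K, G, L] using this
  refine Circle.not_injective_of_continuous (f := fun z => L (1, circleHomeoCircle1 z))
    (L.continuous.comp (by fun_prop)) ?_
  intro z w hzw
  have hzw' : F (f (circleHomeoCircle1 z)) = F (f (circleHomeoCircle1 w)) := by
    rw [← hL, ← hL]; exact congrArg _ hzw
  exact circleHomeoCircle1.injective (hf (hF.injOn (hrange ▸ mem_range_self _)
    (hrange ▸ mem_range_self _) hzw'))

/-- Gluing two copies of a geodesic realizing the distance of two disjoint pieces `P`, `Q` of the
gluing set yields a Jordan curve which some map to the circle restricts to bijectively. -/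
theorem exists_circle_map {X D : Type*} [MetricSpace X] [CompactSpace X] [MetricSpace D]
    (hmid : HasMidpoints X) {ip im : X → D} (hip : Isometry ip) (him : Isometry im)
    (hcov : range ip ∪ range im = univ) {P Q : Set X}
    (hglue : ∀ z ∈ P ∪ Q, ip z = im z) (hsep : ∀ a b, ip a = im b → a = b ∧ a ∈ P ∪ Q)
    {p q : X} (hp : p ∈ P) (hq : q ∈ Q) (hpq : 0 < dist p q)
    (hmin : ∀ x ∈ P, ∀ y ∈ Q, dist p q ≤ dist x y) :
    ∃ (J : Set D) (F : C(D, Circle)), IsCompact J ∧ BijOn F J univ ∧ ip p ∈ J ∧ ip q ∈ J ∧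
      ∀ x ∈ J, ∀ y ∈ J, dist x y ≤ 2 * dist p q := by
  obtain ⟨S, hSc, hpS, hqS, hSd, hSle, hSsurj⟩ := hmid.exists_geodesic_set p q
  set L := dist p q with hL
  let g : X → ℝ := fun x => Real.pi * (min (infDist x P) L / L)
  have hg : Continuous g := by
    have := continuous_infDist_pt P
    fun_prop
  have hgmem : ∀ x, g x ∈ Icc 0 Real.pi := by
    intro x
    have h₁ : min (infDist x P) L / L ≤ 1 := (div_le_one hpq).2 (min_le_right _ _)
    have h₀ : 0 ≤ min (infDist x P) L / L := div_nonneg (le_min infDist_nonneg hpq.le) hpq.le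
    exact ⟨mul_nonneg Real.pi_pos.le h₀, by nlinarith [Real.pi_pos]⟩
  have hgP : ∀ x ∈ P, g x = 0 := by
    intro x hx
    simp [g, infDist_zero_of_mem hx, hpq.le]
  have hgQ : ∀ x ∈ Q, g x = Real.pi := by
    intro x hx
    have : L ≤ infDist x P := (le_infDist ⟨p, hp⟩).2 fun y hy => by
      rw [dist_comm]; exact hmin y hy x hx
    simp [g, min_eq_right this, hpq.ne']
  have hgS : ∀ s ∈ S, g s = Real.pi * (dist p s / L) := by
    intro s hs
    have hle : infDist s P ≤ dist p s := by rw [dist_comm]; exact infDist_le_dist_of_mem hp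
    have hge : dist p s ≤ infDist s P := (le_infDist ⟨p, hp⟩).2 fun y hy => by
      have h₁ := hmin y hy q hq
      have h₂ := dist_triangle y s q
      have h₃ := hSd s hs q hqS
      rw [abs_sub_comm, abs_of_nonneg (by linarith [hSle s hs])] at h₃
      rw [dist_comm s y]
      linarith
    simp only [g]
    rw [le_antisymm hle hge, min_eq_left (hSle s hs)]
  have hginj : ∀ s ∈ S, ∀ t ∈ S, g s = g t → s = t := by
    intro s hs t ht h
    rw [hgS s hs, hgS t ht, mul_right_inj' Real.pi_ne_zero, div_left_inj' hpq.ne'] at h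
    exact dist_eq_zero.1 (by rw [hSd s hs t ht, h]; simp)
  have hgp : g p = 0 := hgP p hp
  have hgq : g q = Real.pi := hgQ q hq
  let π : C(X ⊕ X, D) := ⟨Sum.elim ip im, hip.continuous.sumElim him.continuous⟩
  have hπs : Function.Surjective π := by
    intro d
    rcases (hcov ▸ mem_univ d : d ∈ range ip ∪ range im) with ⟨x, rfl⟩ | ⟨x, rfl⟩
    · exact ⟨Sum.inl x, rfl⟩
    · exact ⟨Sum.inr x, rfl⟩
  have hquot : IsQuotientMap π := π.continuous.isClosedMap.isQuotientMap π.continuous hπs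
  let f : C(X ⊕ X, Circle) :=
    ⟨Sum.elim (fun x => Circle.exp (g x)) (fun x => Circle.exp (-g x)), by
      refine Continuous.sumElim ?_ ?_ <;> fun_prop⟩
  have hend : ∀ z ∈ P ∪ Q, Circle.exp (g z) = Circle.exp (-g z) := by
    rintro z (hz | hz)
    · simp [hgP z hz]
    · rw [hgQ z hz, Circle.exp_eq_exp]
      exact ⟨1, by push_cast; ring⟩
  have hfac : Function.FactorsThrough f π := by
    rintro (a | a) (b | b) hab
    · rw [hip.injective hab]
    · obtain ⟨rfl, hz⟩ := hsep a b hab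
      exact hend a hz
    · obtain ⟨rfl, hz⟩ := hsep b a hab.symm
      exact (hend b hz).symm
    · rw [him.injective hab]
  let F : C(D, Circle) := hquot.lift f hfac
  have hFp : ∀ x, F (ip x) = Circle.exp (g x) := fun x =>
    DFunLike.congr_fun (hquot.lift_comp f hfac) (Sum.inl x)
  have hFm : ∀ x, F (im x) = Circle.exp (-g x) := fun x =>
    DFunLike.congr_fun (hquot.lift_comp f hfac) (Sum.inr x)
  have hmix : ∀ s ∈ S, ∀ t ∈ S, F (ip s) = F (im t) → ip s = im t := by
    intro s hs t ht h
    rw [hFp, hFm] at h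
    obtain ⟨hst, h0⟩ := circle_exp_eq_exp_neg (hgmem s) (hgmem t) h
    obtain rfl := hginj s hs t ht hst
    rcases h0 with h0 | h0
    · obtain rfl := hginj s hs p hpS (h0.trans hgp.symm)
      exact hglue s (Or.inl hp)
    · obtain rfl := hginj s hs q hqS (h0.trans hgq.symm)
      exact hglue s (Or.inr hq)
  have hangle : ∀ a ∈ Icc 0 Real.pi, ∃ s ∈ S, g s = a := by
    intro a ha
    have hpi := Real.pi_pos
    obtain ⟨s, hs, hsr⟩ := hSsurj (a / Real.pi * L)
      ⟨mul_nonneg (div_nonneg ha.1 hpi.le) hpq.le,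
        mul_le_of_le_one_left hpq.le ((div_le_one hpi).2 ha.2)⟩
    refine ⟨s, hs, ?_⟩
    rw [hgS s hs, hsr]
    field_simp
  refine ⟨ip '' S ∪ im '' S, F, (hSc.image hip.continuous).union (hSc.image him.continuous),
    ⟨mapsTo_univ _ _, ?_, ?_⟩, Or.inl ⟨p, hpS, rfl⟩, Or.inl ⟨q, hqS, rfl⟩, ?_⟩
  · rintro _ (⟨s, hs, rfl⟩ | ⟨s, hs, rfl⟩) _ (⟨t, ht, rfl⟩ | ⟨t, ht, rfl⟩) h
    · rw [hFp, hFp] at h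
      rw [hginj s hs t ht (circle_nonneg_angle_injOn (hgmem s) (hgmem t) h)]
    · exact hmix s hs t ht h
    · exact (hmix t ht s hs h.symm).symm
    · rw [hFm, hFm, Circle.exp_neg, Circle.exp_neg, inv_inj] at h
      rw [hginj s hs t ht (circle_nonneg_angle_injOn (hgmem s) (hgmem t) h)]
  · intro z _
    have hz := Circle.exp_arg z
    have harg := Complex.abs_arg_le_pi (z : ℂ)
    rcases le_total 0 (Complex.arg (z : ℂ)) with h | h
    · obtain ⟨s, hs, hgs⟩ := hangle _ ⟨h, (abs_le.1 harg).2⟩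
      exact ⟨ip s, Or.inl ⟨s, hs, rfl⟩, by rw [hFp, hgs, hz]⟩
    · obtain ⟨s, hs, hgs⟩ := hangle (-Complex.arg (z : ℂ))
        ⟨by linarith, by linarith [(abs_le.1 harg).1]⟩
      exact ⟨im s, Or.inr ⟨s, hs, rfl⟩, by rw [hFm, hgs, neg_neg, hz]⟩
  · have hroot : ∀ x ∈ ip '' S ∪ im '' S, dist (ip p) x ≤ L := by
      rintro _ (⟨s, hs, rfl⟩ | ⟨s, hs, rfl⟩)
      · rw [hip.dist_eq]; exact hSle s hs
      · rw [hglue p (Or.inl hp), him.dist_eq]; exact hSle s hs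
    intro x hx y hy
    have := dist_triangle_left x y (ip p)
    linarith [hroot x hx, hroot y hy]

/-! ## Maximal cyclic subsets -/

theorem IsJordanCurve.exists_isMaximalCyclic {X : Type*} [TopologicalSpace X] {J : Set X}
    (hJ : IsJordanCurve J) (hnt : J.Nontrivial) : ∃ T : Set X, IsMaximalCyclic T ∧ J ⊆ T := by
  obtain ⟨T, hJT, hT⟩ := zorn_subset_nonempty {A : Set X | CycliclyConnected A} (by
    intro c hc hchain _
    refine ⟨⋃₀ c, ?_, fun s hs => subset_sUnion_of_mem hs⟩
    rintro x ⟨A, hA, hx⟩ y ⟨B, hB, hy⟩ hxy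
    rcases hchain.total hA hB with h | h
    · obtain ⟨K, hKB, hK⟩ := hc hB x (h hx) y hy hxy
      exact ⟨K, hKB.trans (subset_sUnion_of_mem hB), hK⟩
    · obtain ⟨K, hKA, hK⟩ := hc hA x hx y (h hy) hxy
      exact ⟨K, hKA.trans (subset_sUnion_of_mem hA), hK⟩) J
    (fun x hx y hy _ => ⟨J, Subset.rfl, hJ, hx, hy⟩)
  exact ⟨T, ⟨hnt.mono hJT, hT.prop, fun B hB hTB => hT.eq_of_le hB hTB⟩, hJT⟩

/-! ## Boundary components and regularity -/

theorem isClosed_surfaceBoundary (X : Type*) [TopologicalSpace X] :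
    IsClosed (surfaceBoundary X) := by
  refine ⟨isOpen_iff_forall_mem_open.2 fun x hx => ?_⟩
  obtain ⟨U, V, hU, hxU, hV, hUV⟩ := not_not.1 hx
  exact ⟨U, fun y hy hny => hny ⟨U, V, hU, hy, hV, hUV⟩, hU, hxU⟩

theorem IsClosed.isClosed_connectedComponentIn {X : Type*} [TopologicalSpace X] {F : Set X}
    (hF : IsClosed F) (x : X) : IsClosed (connectedComponentIn F x) := by
  by_cases hx : x ∈ F
  · rw [connectedComponentIn_eq_image hx]
    exact hF.isClosedMap_subtype_val _ isClosed_connectedComponent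
  · rw [connectedComponentIn_eq_empty hx]
    exact isClosed_empty

theorem isClosed_boundary_diff_component {X : Type*} [TopologicalSpace X]
    (hfin : (surfaceBoundaryComponents X).Finite) (x : X) :
    IsClosed (surfaceBoundary X \ connectedComponentIn (surfaceBoundary X) x) := by
  have heq : surfaceBoundary X \ connectedComponentIn (surfaceBoundary X) x =
      ⋃₀ (surfaceBoundaryComponents X \ {connectedComponentIn (surfaceBoundary X) x}) := by
    ext y
    constructor
    · rintro ⟨hy, hyx⟩
      refine ⟨_, ⟨⟨y, hy, rfl⟩, fun h => hyx ?_⟩, mem_connectedComponentIn hy⟩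
      rw [← mem_singleton_iff.1 h]
      exact mem_connectedComponentIn hy
    · rintro ⟨_, ⟨⟨z, hz, rfl⟩, hne⟩, hyz⟩
      exact ⟨connectedComponentIn_subset _ _ hyz, fun hyx =>
        hne ((connectedComponentIn_eq hyz).trans (connectedComponentIn_eq hyx).symm)⟩
  rw [heq, sUnion_eq_biUnion]
  refine hfin.sdiff.isClosed_biUnion ?_
  rintro _ ⟨⟨z, _, rfl⟩, _⟩
  exact (isClosed_surfaceBoundary X).isClosed_connectedComponentIn z

theorem IsCompact.exists_dist_le {X : Type*} [MetricSpace X] {P Q : Set X} (hP : IsCompact P)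
    (hQ : IsCompact Q) (hPne : P.Nonempty) (hQne : Q.Nonempty) :
    ∃ p ∈ P, ∃ q ∈ Q, ∀ x ∈ P, ∀ y ∈ Q, dist p q ≤ dist x y := by
  obtain ⟨⟨p, q⟩, ⟨hp, hq⟩, hmin⟩ := (hP.prod hQ).exists_isMinOn (hPne.prod hQne)
    (f := fun x : X × X => dist x.1 x.2) (by fun_prop)
  exact ⟨p, hp, q, hq, fun x hx y hy => hmin (show (x, y) ∈ P ×ˢ Q from ⟨hx, hy⟩)⟩

theorem IsMetricDouble.eq_and_mem {X D : Type*} [MetricSpace X] [CompactSpace X] [MetricSpace D]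
    {B : Set X} {ip im : X → D} (h : IsMetricDouble X B D ip im) (hB : IsClosed B)
    (hne : B.Nonempty) {a b : X} (hab : ip a = im b) : a = b ∧ a ∈ B := by
  obtain ⟨z, hz, hmin⟩ := hB.isCompact.exists_isMinOn hne
    (f := fun z : X => dist a z + dist z b) (by fun_prop)
  have : Nonempty B := ⟨⟨z, hz⟩⟩
  have hle : dist a z + dist z b ≤ 0 := by
    have hmix := h.dist_mix a b
    rw [hab, dist_self] at hmix
    rw [hmix]
    exact le_ciInf fun w => hmin w.2
  have h₁ := dist_nonneg (x := a) (y := z)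
  have h₂ := dist_nonneg (x := z) (y := b)
  obtain rfl : a = z := dist_eq_zero.1 (by linarith)
  exact ⟨dist_eq_zero.1 (by linarith), hz⟩

theorem IsMetricDouble.exists_nonContractible {X D : Type*} [MetricSpace X] [CompactSpace X]
    [MetricSpace D] {P Q : Set X} {ip im : X → D} (h : IsMetricDouble X (P ∪ Q) D ip im)
    (hmid : HasMidpoints X) (hP : IsClosed P) (hQ : IsClosed Q) (hPQ : Disjoint P Q)
    {x y : X} (hx : x ∈ P) (hy : y ∈ Q) :
    ∃ J : Set D, IsNonContractibleJordanCurve J ∧ Metric.diam J ≤ 2 * dist x y := by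
  obtain ⟨p, hp, q, hq, hmin⟩ :=
    hP.isCompact.exists_dist_le hQ.isCompact ⟨x, hx⟩ ⟨y, hy⟩
  have hpq : 0 < dist p q := dist_pos.2 (hPQ.ne_of_mem hp hq)
  obtain ⟨J, F, hJ, hF, -, -, hdiam⟩ := exists_circle_map hmid h.isom_p h.isom_m h.surj h.agree
    (fun a b hab => h.eq_and_mem (hP.union hQ) ⟨x, Or.inl hx⟩ hab) hp hq hpq hmin
  refine ⟨J, isNonContractibleJordanCurve_of_bijOn hJ F hF, ?_⟩
  refine (diam_le_of_forall_dist_le (by positivity) hdiam).trans ?_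
  linarith [hmin x hx y hy]

/-- In a regular sequence of doubles, the non-contractible Jordan curves eventually have
diameters bounded below uniformly. -/
theorem RegularDoubleSeq.exists_diam_lower_bound {D : ℕ → Type} [∀ n, MetricSpace (D n)]
    (hreg : RegularDoubleSeq D) (hne : ∀ n, ∃ J : Set (D n), IsNonContractibleJordanCurve J) :
    ∃ ε > 0, ∀ᶠ n in atTop, ∀ J : Set (D n), IsNonContractibleJordanCurve J → ε ≤ diam J := by
  let A : ∀ n, Set ℝ := fun n => diam '' {J : Set (D n) | IsNonContractibleJordanCurve J}
  have hbdd : ∀ n, BddBelow (A n) := fun n => ⟨0, by rintro _ ⟨J, _, rfl⟩; exact diam_nonneg⟩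
  have hex : ∀ n : ℕ, ∃ J : Set (D n), IsNonContractibleJordanCurve J ∧
      diam J < sInf (A n) + 1 / ((n : ℝ) + 1) := by
    intro n
    have hAne : (A n).Nonempty := (hne n).elim fun J hJ => ⟨_, J, hJ, rfl⟩
    obtain ⟨_, ⟨J, hJ, rfl⟩, hlt⟩ := exists_lt_of_csInf_lt hAne
      (lt_add_of_pos_right (sInf (A n)) (Nat.one_div_pos_of_nat (n := n)))
    exact ⟨J, hJ, hlt⟩
  choose J hJ hJlt using hex
  have hpos := hreg J hJ
  set ε := ⨅ n, diam (J n) with hε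
  refine ⟨ε / 2, half_pos hpos, ?_⟩
  have hlim : Tendsto (fun n : ℕ => 1 / ((n : ℝ) + 1)) atTop (𝓝 0) :=
    tendsto_one_div_add_atTop_nhds_zero_nat
  filter_upwards [hlim.eventually_lt_const (half_pos hpos)] with n hn K hK
  have h₁ : ε ≤ diam (J n) := ciInf_le ⟨0, by rintro _ ⟨m, rfl⟩; exact diam_nonneg⟩ n
  have h₂ : sInf (A n) ≤ diam K := csInf_le (hbdd n) ⟨K, hK, rfl⟩
  linarith [hJlt n]

/-! ## Hausdorff limits -/

theorem eventually_near_of_tendsto_hausdorffEDist {Z : Type*} [MetricSpace Z] {K : ℕ → Set Z}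
    {B : Set Z} (h : Tendsto (fun n => hausdorffEDist (K n) B) atTop (𝓝 0)) {δ : ℝ} (hδ : 0 < δ) :
    ∀ᶠ n in atTop, (∀ x ∈ K n, ∃ y ∈ B, dist x y < δ) ∧ ∀ y ∈ B, ∃ x ∈ K n, dist x y < δ := by
  filter_upwards [h.eventually_lt_const (ENNReal.ofReal_pos.2 hδ)] with n hn
  constructor
  · intro x hx
    obtain ⟨y, hy, hxy⟩ := exists_edist_lt_of_hausdorffEDist_lt hx hn
    exact ⟨y, hy, by rwa [edist_dist, ENNReal.ofReal_lt_ofReal_iff hδ] at hxy⟩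
  · intro y hy
    rw [hausdorffEDist_comm] at hn
    obtain ⟨x, hx, hxy⟩ := exists_edist_lt_of_hausdorffEDist_lt hy hn
    refine ⟨x, hx, ?_⟩
    rwa [edist_dist, ENNReal.ofReal_lt_ofReal_iff hδ, dist_comm] at hxy

/-- If nearby points of the approximating sets are joined by connected subsets, then nearby points
of the Hausdorff limit lie in the same component. -/
theorem mem_connectedComponentIn_of_hausdorff_limit {Z : Type*} [MetricSpace Z] {K : ℕ → Set Z}
    {B : Set Z} (hB : IsCompact B) (h : Tendsto (fun n => hausdorffEDist (K n) B) atTop (𝓝 0))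
    {ε : ℝ} (hK : ∀ᶠ n in atTop, ∀ x ∈ K n, ∀ y ∈ K n, dist x y < ε →
      ∃ C ⊆ K n, IsPreconnected C ∧ x ∈ C ∧ y ∈ C)
    {v w : Z} (hv : v ∈ B) (hw : w ∈ B) (hvw : dist v w < ε) :
    w ∈ connectedComponentIn B v := by
  have : CompactSpace B := isCompact_iff_compactSpace.1 hB
  rw [connectedComponentIn_eq_image hv]
  refine ⟨⟨w, hw⟩, ?_, rfl⟩
  rw [connectedComponent_eq_iInter_isClopen, mem_iInter]
  rintro ⟨s, hs, hvs⟩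
  by_contra hws
  have hdisj : Disjoint (Subtype.val '' s) (Subtype.val '' sᶜ) :=
    (disjoint_image_iff Subtype.val_injective).2 disjoint_compl_right
  obtain ⟨δ, hδ, hthick⟩ := hdisj.exists_thickenings
    (hs.isClosed.isCompact.image continuous_subtype_val)
    (hs.compl.isClosed.isCompact.image continuous_subtype_val).isClosed
  obtain ⟨n, hn, hKn⟩ := ((eventually_near_of_tendsto_hausdorffEDist h
    (lt_min hδ (half_pos (sub_pos.2 hvw)))).and hK).exists
  obtain ⟨v', hv', hvv'⟩ := hn.2 v hv
  obtain ⟨w', hw', hww'⟩ := hn.2 w hw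
  have hvv₁ := hvv'.trans_le (min_le_left _ _)
  have hvv₂ := hvv'.trans_le (min_le_right _ _)
  have hww₁ := hww'.trans_le (min_le_left _ _)
  have hww₂ := hww'.trans_le (min_le_right _ _)
  have hvw' : dist v' w' < ε := by
    have := dist_triangle4 v' v w w'
    rw [dist_comm w w'] at this
    linarith
  obtain ⟨C, hCK, hC, hvC, hwC⟩ := hKn v' hv' w' hw' hvw'
  have hv'th : v' ∈ thickening δ (Subtype.val '' s) :=
    mem_thickening_iff.2 ⟨v, ⟨⟨v, hv⟩, hvs, rfl⟩, hvv₁⟩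
  have hw'th : w' ∈ thickening δ (Subtype.val '' sᶜ) :=
    mem_thickening_iff.2 ⟨w, ⟨⟨w, hw⟩, hws, rfl⟩, hww₁⟩
  have hcover : C ⊆ thickening δ (Subtype.val '' s) ∪ thickening δ (Subtype.val '' sᶜ) := by
    intro x hx
    obtain ⟨y, hy, hxy⟩ := hn.1 x (hCK hx)
    have hxy₁ := hxy.trans_le (min_le_left _ _)
    by_cases hys : (⟨y, hy⟩ : B) ∈ s
    · exact Or.inl (mem_thickening_iff.2 ⟨y, ⟨⟨y, hy⟩, hys, rfl⟩, hxy₁⟩)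
    · exact Or.inr (mem_thickening_iff.2 ⟨y, ⟨⟨y, hy⟩, hys, rfl⟩, hxy₁⟩)
  have hsub := IsPreconnected.subset_left_of_subset_union isOpen_thickening isOpen_thickening
    hthick hcover ⟨v', hvC, hv'th⟩ hC
  exact hthick.ne_of_mem (hsub hwC) hw'th rfl

/-- A Hausdorff limit of sets which split into two uniformly separated pieces is disconnected. -/
theorem not_isPreconnected_of_hausdorff_limit {Z : Type*} [MetricSpace Z] {K : ℕ → Set Z}
    {B : Set Z} (h : Tendsto (fun n => hausdorffEDist (K n) B) atTop (𝓝 0))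
    {ε : ℝ} (hε : 0 < ε) (hK : ∀ᶠ n in atTop, ∃ P Q : Set Z, P.Nonempty ∧ Q.Nonempty ∧
      P ∪ Q = K n ∧ ∀ x ∈ P, ∀ y ∈ Q, ε ≤ dist x y) :
    ¬ IsPreconnected B := by
  intro hB
  obtain ⟨n, hn, P, Q, ⟨p, hp⟩, ⟨q, hq⟩, hPQ, hsep⟩ :=
    ((eventually_near_of_tendsto_hausdorffEDist h (half_pos hε)).and hK).exists
  have hdisj : Disjoint (thickening (ε / 2) P) (thickening (ε / 2) Q) := by
    refine disjoint_left.2 fun x hxP hxQ => ?_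
    obtain ⟨a, ha, hxa⟩ := mem_thickening_iff.1 hxP
    obtain ⟨b, hb, hxb⟩ := mem_thickening_iff.1 hxQ
    linarith [hsep a ha b hb, dist_triangle_left a b x]
  have hcover : B ⊆ thickening (ε / 2) P ∪ thickening (ε / 2) Q := by
    intro y hy
    obtain ⟨x, hx, hxy⟩ := hn.2 y hy
    rw [dist_comm] at hxy
    rcases (hPQ ▸ hx : x ∈ P ∪ Q) with hx | hx
    · exact Or.inl (mem_thickening_iff.2 ⟨x, hx, hxy⟩)
    · exact Or.inr (mem_thickening_iff.2 ⟨x, hx, hxy⟩)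
  obtain ⟨y, hy, hpy⟩ := hn.1 p (hPQ ▸ Or.inl hp)
  obtain ⟨z, hz, hqz⟩ := hn.1 q (hPQ ▸ Or.inr hq)
  rw [dist_comm] at hpy hqz
  have hsub := IsPreconnected.subset_left_of_subset_union isOpen_thickening isOpen_thickening
    hdisj hcover ⟨y, hy, mem_thickening_iff.2 ⟨p, hp, hpy⟩⟩ hB
  exact hdisj.ne_of_mem (hsub hz) (mem_thickening_iff.2 ⟨q, hq, hqz⟩) rfl

/-- Midpoints pass to Hausdorff limits. -/
theorem hasMidpoints_of_hausdorff_limit {Z : Type*} [MetricSpace Z] {Xs : ℕ → Type*}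
    [∀ n, MetricSpace (Xs n)] (hmid : ∀ n, HasMidpoints (Xs n)) {e : ∀ n, Xs n → Z}
    (hiso : ∀ n, Isometry (e n)) {X : Set Z} [CompactSpace X]
    (h : Tendsto (fun n => hausdorffEDist (range (e n)) X) atTop (𝓝 0)) :
    HasMidpoints X := by
  refine hasMidpoints_of_approx fun x y ε hε => ?_
  obtain ⟨n, hn⟩ := (eventually_near_of_tendsto_hausdorffEDist h
    (show 0 < ε / 3 by positivity)).exists
  obtain ⟨_, ⟨a, rfl⟩, ha⟩ := hn.2 x x.2
  obtain ⟨_, ⟨b, rfl⟩, hb⟩ := hn.2 y y.2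
  obtain ⟨m, hm₁, hm₂⟩ := hmid n a b
  obtain ⟨k, hk, hmk⟩ := hn.1 (e n m) ⟨m, rfl⟩
  rw [← (hiso n).dist_eq, ← (hiso n).dist_eq a b] at hm₁ hm₂
  have hab := dist_triangle4 (e n a) x y (e n b)
  have h₁ := dist_triangle4 (x : Z) (e n a) (e n m) k
  have h₂ := dist_triangle4 k (e n m) (e n b) y
  rw [dist_comm (y : Z) (e n b)] at hab
  rw [dist_comm (x : Z) (e n a)] at h₁
  rw [dist_comm k (e n m)] at h₂
  refine ⟨⟨k, hk⟩, ?_, ?_⟩ <;> simp only [Subtype.dist_eq] <;> linarith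

/-! ## Uniform separation of the boundary components -/

theorem exists_not_mem_component {X : Type*} [TopologicalSpace X]
    (h : (surfaceBoundaryComponents X).Nontrivial) :
    ∃ x ∈ surfaceBoundary X, ∃ y ∈ surfaceBoundary X,
      y ∉ connectedComponentIn (surfaceBoundary X) x := by
  obtain ⟨_, ⟨x, hx, rfl⟩, _, ⟨y, hy, rfl⟩, hne⟩ := h
  exact ⟨x, hx, y, hy, fun hyx => hne (connectedComponentIn_eq hyx)⟩

theorem exists_boundary_separation {Xs : ℕ → Type} [∀ n, MetricSpace (Xs n)]
    [∀ n, CompactSpace (Xs n)] (hmid : ∀ n, HasMidpoints (Xs n))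
    (hcomps : ∀ n, (surfaceBoundaryComponents (Xs n)).Nontrivial ∧
      (surfaceBoundaryComponents (Xs n)).Finite)
    {D : ℕ → Type} [∀ n, MetricSpace (D n)] {ip im : ∀ n, Xs n → D n}
    (hdouble : ∀ n, IsMetricDouble (Xs n) (surfaceBoundary (Xs n)) (D n) (ip n) (im n))
    (hreg : RegularDoubleSeq D) :
    ∃ ε > 0, ∀ᶠ n in atTop, ∀ x ∈ surfaceBoundary (Xs n), ∀ y ∈ surfaceBoundary (Xs n),
      y ∉ connectedComponentIn (surfaceBoundary (Xs n)) x → ε ≤ dist x y := by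
  have hcurve : ∀ n, ∀ x ∈ surfaceBoundary (Xs n), ∀ y ∈ surfaceBoundary (Xs n),
      y ∉ connectedComponentIn (surfaceBoundary (Xs n)) x →
      ∃ J : Set (D n), IsNonContractibleJordanCurve J ∧ diam J ≤ 2 * dist x y := by
    intro n x hx y hy hyx
    refine IsMetricDouble.exists_nonContractible
      (P := connectedComponentIn (surfaceBoundary (Xs n)) x)
      (Q := surfaceBoundary (Xs n) \ connectedComponentIn (surfaceBoundary (Xs n)) x)
      (ip := ip n) (im := im n) ?_ (hmid n)
      ((isClosed_surfaceBoundary _).isClosed_connectedComponentIn x)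
      (isClosed_boundary_diff_component (hcomps n).2 x) disjoint_sdiff_right
      (mem_connectedComponentIn hx) ⟨hy, hyx⟩
    rw [union_sdiff_cancel (connectedComponentIn_subset _ _)]
    exact hdouble n
  obtain ⟨ε, hε, hlow⟩ := hreg.exists_diam_lower_bound fun n => by
    obtain ⟨x, hx, y, hy, hyx⟩ := exists_not_mem_component (hcomps n).1
    obtain ⟨J, hJ, -⟩ := hcurve n x hx y hy hyx
    exact ⟨J, hJ⟩
  refine ⟨ε / 2, half_pos hε, ?_⟩
  filter_upwards [hlow] with n hn x hx y hy hyx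
  obtain ⟨J, hJ, hJd⟩ := hcurve n x hx y hy hyx
  linarith [hn J hJ]

/-! ## STATEMENT 17 -/

theorem stmt17 (c : ℤ) (q : ℕ) (hq : 1 < q)
    (Xs : ℕ → Type) [∀ n, MetricSpace (Xs n)]
    (hsurf : ∀ n, IsCompactSurface (Xs n)) (hlen : ∀ n, IsLengthSpace (Xs n))
    (hnb : ∀ n, (surfaceBoundaryComponents (Xs n)).ncard = q)
    (hrc : ∀ n, redConnNum (Xs n) = c)
    (D : ℕ → Type) [∀ n, MetricSpace (D n)] [∀ n, CompactSpace (D n)] [∀ n, Nonempty (D n)]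
    (ip im : ∀ n, Xs n → D n)
    (hdouble : ∀ n, IsMetricDouble (Xs n) (surfaceBoundary (Xs n)) (D n) (ip n) (im n))
    (hreg : RegularDoubleSeq D)
    (Z : Type) [MetricSpace Z] [CompactSpace Z]
    (e : ∀ n, Xs n → Z) (hiso : ∀ n, Isometry (e n))
    (X : Set Z) (hXcl : IsClosed X) (hXne : X.Nonempty)
    (hconv : Filter.Tendsto (fun n => EMetric.hausdorffEdist (Set.range (e n)) X)
      Filter.atTop (nhds 0))
    (Binf : Set Z) (hBcl : IsClosed Binf) (hBsub : Binf ⊆ X)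
    (hBconv : Filter.Tendsto
      (fun n => EMetric.hausdorffEdist (e n '' surfaceBoundary (Xs n)) Binf)
      Filter.atTop (nhds 0))
    (Dinf : Type) [MetricSpace Dinf] [CompactSpace Dinf] [Nonempty Dinf]
    (hDconv : Filter.Tendsto (fun n => GromovHausdorff.toGHSpace (D n)) Filter.atTop
      (nhds (GromovHausdorff.toGHSpace Dinf)))
    (Xp Xm : Set Dinf) (hunion : Xp ∪ Xm = Set.univ)
    (jp : ↥X ≃ᵢ ↥Xp) (jm : ↥X ≃ᵢ ↥Xm)
    (τp τm : Dinf → Dinf)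
    (hτpr : Set.range τp = Xp) (hτmr : Set.range τm = Xm)
    (hτpfix : ∀ d ∈ Xp, τp d = d) (hτmfix : ∀ d ∈ Xm, τm d = d)
    (hτpiso : Isometry fun x : ↥Xm => τp ↑x)
    (hτmiso : Isometry fun x : ↥Xp => τm ↑x)
    (hτpm : ∀ d ∈ Xp, τp (τm d) = d) (hτmp : ∀ d ∈ Xm, τm (τp d) = d)
    (hτpj : ∀ x : ↥X, τp ↑(jm x) = ↑(jp x)) (hτmj : ∀ x : ↥X, τm ↑(jp x) = ↑(jm x))
    (hcapp : Xp ∩ Xm = plusCopy (⇑jp) Binf)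
    (hcapm : Xp ∩ Xm = plusCopy (⇑jm) Binf)
    (bcomp : Set Z) (hbc : ∃ z ∈ Binf, bcomp = connectedComponentIn Binf z) :
    ∃ T : Set Dinf, IsMaximalCyclic T ∧ (T ∩ plusCopy (⇑jp) bcomp).Nonempty ∧
      ∃ bcomp' : Set Z, (∃ z ∈ Binf, bcomp' = connectedComponentIn Binf z) ∧
        bcomp' ≠ bcomp ∧ (T ∩ plusCopy (⇑jp) bcomp').Nonempty := by
  have hcpt : ∀ n, CompactSpace (Xs n) := fun n => (hsurf n).1
  have : CompactSpace X := isCompact_iff_compactSpace.1 hXcl.isCompact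
  have hmidn : ∀ n, HasMidpoints (Xs n) := fun n =>
    hasMidpoints_of_approx fun x y ε hε => (hlen n).exists_approx_midpoint x y hε
  have hmid : HasMidpoints X := hasMidpoints_of_hausdorff_limit hmidn hiso hconv
  have hcomps : ∀ n, (surfaceBoundaryComponents (Xs n)).Nontrivial ∧
      (surfaceBoundaryComponents (Xs n)).Finite := fun n =>
    one_lt_ncard_iff_nontrivial_and_finite.1 (by rw [hnb n]; exact hq)
  obtain ⟨ε, hε, hsep⟩ := exists_boundary_separation hmidn hcomps hdouble hreg
  have hnear : ∀ v ∈ Binf, ∀ w ∈ Binf, dist v w < ε → w ∈ connectedComponentIn Binf v := by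
    intro v hv w hw hvw
    refine mem_connectedComponentIn_of_hausdorff_limit hBcl.isCompact hBconv ?_ hv hw hvw
    filter_upwards [hsep] with n hn
    rintro _ ⟨x, hx, rfl⟩ _ ⟨y, hy, rfl⟩ hxy
    rw [(hiso n).dist_eq] at hxy
    have hyx : y ∈ connectedComponentIn (surfaceBoundary (Xs n)) x := by
      by_contra hyx
      exact absurd (hn x hx y hy hyx) (not_le.2 hxy)
    exact ⟨_, image_mono (connectedComponentIn_subset _ x),
      isPreconnected_connectedComponentIn.image _ (hiso n).continuous.continuousOn,
      mem_image_of_mem _ (mem_connectedComponentIn hx), mem_image_of_mem _ hyx⟩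
  have hdisc : ¬ IsPreconnected Binf := by
    refine not_isPreconnected_of_hausdorff_limit hBconv hε ?_
    filter_upwards [hsep] with n hn
    obtain ⟨x, hx, y, hy, hyx⟩ := exists_not_mem_component (hcomps n).1
    refine ⟨e n '' connectedComponentIn (surfaceBoundary (Xs n)) x,
      e n '' (surfaceBoundary (Xs n) \ connectedComponentIn (surfaceBoundary (Xs n)) x),
      ⟨_, mem_image_of_mem _ (mem_connectedComponentIn hx)⟩,
      ⟨_, mem_image_of_mem _ ⟨hy, hyx⟩⟩, ?_, ?_⟩
    · rw [← image_union, union_sdiff_cancel (connectedComponentIn_subset _ _)]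
    · rintro _ ⟨a, ha, rfl⟩ _ ⟨b, ⟨hb, hbx⟩, rfl⟩
      rw [(hiso n).dist_eq]
      refine hn a (connectedComponentIn_subset _ _ ha) b hb ?_
      rwa [← connectedComponentIn_eq ha]
  obtain ⟨z, hz, rfl⟩ := hbc
  have hbsub : connectedComponentIn Binf z ⊆ Binf := connectedComponentIn_subset _ _
  obtain ⟨y, hy, hyz⟩ : ∃ y ∈ Binf, y ∉ connectedComponentIn Binf z := by
    by_contra! hall
    exact hdisc (hbsub.antisymm hall ▸ isPreconnected_connectedComponentIn)
  have hQcl : IsClosed (Binf \ connectedComponentIn Binf z) := by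
    refine isClosed_of_closure_subset fun w hw => ?_
    have hwB : w ∈ Binf := closure_minimal sdiff_subset hBcl hw
    refine ⟨hwB, fun hwz => ?_⟩
    obtain ⟨v, ⟨hv, hvz⟩, hwv⟩ := Metric.mem_closure_iff.1 hw ε hε
    rw [connectedComponentIn_eq hwz] at hvz
    exact hvz (hnear w hwB v hv hwv)
  have hPcl : IsClosed (connectedComponentIn Binf z) := hBcl.isClosed_connectedComponentIn z
  let P : Set X := Subtype.val ⁻¹' connectedComponentIn Binf z
  let Q : Set X := Subtype.val ⁻¹' (Binf \ connectedComponentIn Binf z)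
  obtain ⟨p, hp, r, hr, hmin⟩ := IsCompact.exists_dist_le (P := P) (Q := Q)
    (hPcl.preimage continuous_subtype_val).isCompact
    (hQcl.preimage continuous_subtype_val).isCompact
    ⟨⟨z, hBsub hz⟩, mem_connectedComponentIn hz⟩ ⟨⟨y, hBsub hy⟩, hy, hyz⟩
  have hpr : 0 < dist p r := dist_pos.2 fun h => hr.2 (h ▸ hp)
  have hglueB : ∀ x : X, (x : Z) ∈ Binf → (jp x : Dinf) = jm x := by
    intro x hx
    have hmem : (jp x : Dinf) ∈ Xp ∩ Xm := hcapp ▸ ⟨x, hx, rfl⟩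
    rw [← hτmj x, hτmfix _ hmem.2]
  have hPQ : ∀ x : X, x ∈ P ∪ Q ↔ (x : Z) ∈ Binf := by
    intro x
    rw [← preimage_union, union_sdiff_cancel hbsub]
    rfl
  have hsepB : ∀ a b : X, (jp a : Dinf) = jm b → a = b ∧ a ∈ P ∪ Q := by
    intro a b hab
    have hmem : (jp a : Dinf) ∈ Xp ∩ Xm := ⟨(jp a).2, hab ▸ (jm b).2⟩
    rw [hcapp] at hmem
    obtain ⟨x, hx, hxa⟩ := hmem
    obtain rfl : x = a := jp.injective (Subtype.ext hxa)
    refine ⟨jm.injective (Subtype.ext ?_), (hPQ x).2 hx⟩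
    rw [← hab, hglueB x hx]
  have hcov : range (fun x => (jp x : Dinf)) ∪ range (fun x => (jm x : Dinf)) = univ := by
    rw [← hunion]
    have hrp : range (fun x => (jp x : Dinf)) = Xp := by
      ext d
      exact ⟨by rintro ⟨x, rfl⟩; exact (jp x).2, fun hd => ⟨jp.symm ⟨d, hd⟩, by simp⟩⟩
    have hrm : range (fun x => (jm x : Dinf)) = Xm := by
      ext d
      exact ⟨by rintro ⟨x, rfl⟩; exact (jm x).2, fun hd => ⟨jm.symm ⟨d, hd⟩, by simp⟩⟩
    rw [hrp, hrm]
  obtain ⟨J, F, hJc, hF, hpJ, hrJ, -⟩ := exists_circle_map hmid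
    (isometry_subtype_coe.comp jp.isometry) (isometry_subtype_coe.comp jm.isometry) hcov
    (fun x hx => hglueB x ((hPQ x).1 hx)) hsepB hp hr hpr hmin
  have hne : (jp p : Dinf) ≠ jp r := fun h =>
    hpr.ne' (dist_eq_zero.2 (jp.injective (Subtype.ext h)))
  obtain ⟨T, hT, hJT⟩ := (isNonContractibleJordanCurve_of_bijOn hJc F hF).1.exists_isMaximalCyclic
    ⟨_, hpJ, _, hrJ, hne⟩
  refine ⟨T, hT, ⟨jp p, hJT hpJ, p, hp, rfl⟩, connectedComponentIn Binf r, ⟨r, hr.1, rfl⟩, ?_,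
    ⟨jp r, hJT hrJ, r, mem_connectedComponentIn hr.1, rfl⟩⟩
  intro heq
  exact hr.2 (heq ▸ mem_connectedComponentIn hr.1)
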